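/- arXiv:2007.06387 — 2 statements merged into one kernel-verified Lean document; each statement's English description precedes it below -/
import Mathlib

section
/- Let 0 < q₁ ≤ q₂ ≤ s₂ ≤ s₁ < ∞ and suppose that for both parameter pairs (s₁, q₁) and (s₂, q₂) the hypotheses of the Pietsch domination theorem for mixing maps hold, namely: H satisfies Condition (I), M satisfies Condition (III), Conditions (II) and (VI) hold, and Condition (VII) holds for the exponents s₁ and s₂. Then every H–M-((s₁;q₁),q₁)-mixing map T ∈ 𝓗 (from A into B) is H–M-((s₂;q₂),q₂)-mixing; that is, 𝔐_{((s₁;q₁),q₁)}^{H–M}(A,B) ⊆ 𝔐_{((s₂;q₂),q₂)}^{H–M}(A,B). -/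
open MeasureTheory Finset

/-- The mixed `(s;q)`-norm `m^M_{(s;q)}` of a finite family, where `Mf j ψ` stands for
`M(T, a_j, c_j, g_j, ψ)` and the index `r` is determined by `1/r = 1/q - 1/s`
(for `q = s`, `r = ∞` and the `ℓ_r`-factor is the sup-norm). -/
noncomputable def mixedNorm (q s : ℝ) {W : Type*} {m : ℕ}
    (σ : Fin m → ℝ) (Mf : Fin m → W → ℝ) : ℝ :=
  sInf { x : ℝ | ∃ τ : Fin m → ℝ, (∀ j, τ j ≠ 0) ∧
    x = (if q = s then ⨆ j, |τ j|
         else (∑ j, |τ j| ^ (1 / q - 1 / s)⁻¹) ^ (1 / q - 1 / s)) *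
        ⨆ ψ : W, (∑ j, |σ j / τ j| ^ s * |Mf j ψ| ^ s) ^ (1 / s) }

/-- `U` satisfies the `H'–Q'`-abstract `p`-summing inequality with constant `δ`
(supremum taken over the compact space `K'`). -/
def SummingCond (p : ℝ) {U A' C G K' : Type*}
    (Q : U → A' → C → G → ℝ) (H : A' → C → G → K' → ℝ) (u : U) (δ : ℝ) : Prop :=
  ∀ m : ℕ, ∀ σ : Fin m → ℝ, (∀ j, σ j ≠ 0) →
    ∀ a : Fin m → A', ∀ c : Fin m → C, ∀ g : Fin m → G,
    (∑ j, |σ j| ^ p * |Q u (a j) (c j) (g j)| ^ p) ^ (1 / p) ≤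
      δ * ⨆ φ : K', (∑ j, |σ j| ^ p * |H (a j) (c j) (g j) φ| ^ p) ^ (1 / p)

/-- `T` satisfies the `H–M`-`((s;q),p)`-mixing inequality with constant `δ`. -/
def MixingCond (q s p : ℝ) {U A' C G K' W : Type*}
    (M : U → A' → C → G → W → ℝ) (H : A' → C → G → K' → ℝ) (u : U) (δ : ℝ) : Prop :=
  ∀ m : ℕ, ∀ σ : Fin m → ℝ, (∀ j, σ j ≠ 0) →
    ∀ a : Fin m → A', ∀ c : Fin m → C, ∀ g : Fin m → G,
    mixedNorm q s σ (fun j ψ => M u (a j) (c j) (g j) ψ) ≤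
      δ * ⨆ φ : K', (∑ j, |σ j| ^ p * |H (a j) (c j) (g j) φ| ^ p) ^ (1 / p)

lemma aux_holder {ι : Type*} [Fintype ι] {q s : ℝ} (hq : 0 < q) (hqs : q < s) (f g : ι → ℝ)
    (hf : ∀ i, 0 ≤ f i) (hg : ∀ i, 0 ≤ g i) :
    (∑ i, (f i * g i) ^ q) ^ (1 / q) ≤
      (∑ i, f i ^ (1 / q - 1 / s)⁻¹) ^ (1 / q - 1 / s) * (∑ i, g i ^ s) ^ (1 / s) := by
  have hs : 0 < s := hq.trans hqs
  have hθ : 0 < 1 / q - 1 / s := sub_pos.2 (one_div_lt_one_div_of_lt hq hqs)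
  have ht : Real.HolderTriple (1 / q - 1 / s)⁻¹ s q :=
    ⟨by rw [inv_inv]; ring, inv_pos.2 hθ, hs⟩
  have h := Real.Lr_rpow_le_Lp_mul_Lq_of_nonneg Finset.univ ht
    (fun i _ => hf i) (fun i _ => hg i)
  have hF : 0 ≤ ∑ i, f i ^ (1 / q - 1 / s)⁻¹ :=
    Finset.sum_nonneg fun i _ => Real.rpow_nonneg (hf i) _
  have hG : 0 ≤ ∑ i, g i ^ s := Finset.sum_nonneg fun i _ => Real.rpow_nonneg (hg i) _
  have h2 := Real.rpow_le_rpow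
    (Finset.sum_nonneg fun i _ => Real.rpow_nonneg (mul_nonneg (hf i) (hg i)) _) h
    (one_div_pos.2 hq).le
  refine h2.trans (le_of_eq ?_)
  rw [Real.mul_rpow (Real.rpow_nonneg hF _) (Real.rpow_nonneg hG _), ← Real.rpow_mul hF,
    ← Real.rpow_mul hG]
  congr 2
  · rw [div_inv_eq_mul]; field_simp
  · field_simp

lemma aux_core {m : ℕ} (V : Set (Fin m → ℝ)) (hV : IsCompact V) (hc : Convex ℝ V)
    (hne : V.Nonempty) (hnn : ∀ v ∈ V, ∀ j, 0 ≤ v j) {p : ℝ} (hp : 0 < p) (hp1 : p ≤ 1) (S : ℝ)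
    (hS : ∀ v ∈ V, ∑ j, v j ^ p ≤ S) {ε : ℝ} (hε : 0 < ε) :
    ∃ y : Fin m → ℝ, (∀ j, 0 < y j) ∧ ∑ j, y j ^ p ≤ S + m * ε ^ p ∧
      ∀ v ∈ V, ∑ j, v j * y j ^ (p - 1) ≤ ∑ j, y j ^ p := by
  have hcont : Continuous fun v : Fin m → ℝ => ∑ j, (v j + ε) ^ p := by
    refine continuous_finsetSum _ fun j _ => ?_
    exact Continuous.rpow_const (by fun_prop) fun _ => Or.inr hp.le
  obtain ⟨x, hxV, hmax⟩ := hV.exists_isMaxOn hne hcont.continuousOn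
  have hpos : ∀ j, 0 < x j + ε := fun j => add_pos_of_nonneg_of_pos (hnn x hxV j) hε
  refine ⟨fun j => x j + ε, hpos, ?_, ?_⟩
  · calc ∑ j, (x j + ε) ^ p ≤ ∑ j, (x j ^ p + ε ^ p) :=
          Finset.sum_le_sum fun j _ =>
            Real.rpow_add_le_add_rpow (hnn x hxV j) hε.le hp.le hp1
      _ ≤ S + m * ε ^ p := by
          rw [Finset.sum_add_distrib]
          simp only [Finset.sum_const, Finset.card_univ, Fintype.card_fin, nsmul_eq_mul]
          linarith [hS x hxV]
  · intro v hv
    have hd : HasFDerivAt (fun v : Fin m → ℝ => ∑ j, (v j + ε) ^ p)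
        (∑ j, (p * (x j + ε) ^ (p - 1)) • (ContinuousLinearMap.proj (R := ℝ) (φ := fun _ : Fin m => ℝ) j)) x := by
      refine HasFDerivAt.fun_sum fun j _ => ?_
      have h1 : HasFDerivAt (fun v : Fin m → ℝ => v j + ε)
          (ContinuousLinearMap.proj (R := ℝ) (φ := fun _ : Fin m => ℝ) j) x :=
        (ContinuousLinearMap.proj (R := ℝ) (φ := fun _ : Fin m => ℝ) j).hasFDerivAt.add_const ε
      exact h1.rpow_const (Or.inl (hpos j).ne')
    have h2 := hmax.localize.hasFDerivWithinAt_nonpos hd.hasFDerivWithinAt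
      (sub_mem_posTangentConeAt_of_segment_subset (hc.segment_subset hxV hv))
    have h3 : p * ∑ j, (x j + ε) ^ (p - 1) * (v j - x j) ≤ 0 := by
      rw [Finset.mul_sum]
      simpa [mul_assoc] using h2
    have h4 : ∑ j, (x j + ε) ^ (p - 1) * (v j - x j) ≤ 0 := by
      by_contra hcon
      push Not at hcon
      exact absurd h3 (not_le.2 (mul_pos hp hcon))
    have h5 : ∀ j, v j * (x j + ε) ^ (p - 1) ≤
        (x j + ε) ^ (p - 1) * (v j - x j) + (x j + ε) ^ p := by
      intro j
      have : (x j + ε) ^ p = (x j + ε) ^ (p - 1) * (x j + ε) := by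
        rw [← Real.rpow_add_one (hpos j).ne']; congr 1; ring
      rw [this]
      nlinarith [Real.rpow_nonneg (hpos j).le (p - 1)]
    calc _ ≤ ∑ j, ((x j + ε) ^ (p - 1) * (v j - x j) + (x j + ε) ^ p) :=
          Finset.sum_le_sum fun j _ => h5 j
      _ ≤ _ := by rw [Finset.sum_add_distrib]; linarith

lemma mixedNorm_bdd (q s : ℝ) {W : Type*} {m : ℕ} (σ : Fin m → ℝ) (Mf : Fin m → W → ℝ) :
    ∀ x ∈ { x : ℝ | ∃ τ : Fin m → ℝ, (∀ j, τ j ≠ 0) ∧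
    x = (if q = s then ⨆ j, |τ j|
         else (∑ j, |τ j| ^ (1 / q - 1 / s)⁻¹) ^ (1 / q - 1 / s)) *
        ⨆ ψ : W, (∑ j, |σ j / τ j| ^ s * |Mf j ψ| ^ s) ^ (1 / s) }, 0 ≤ x := by
  rintro x ⟨τ, -, rfl⟩
  refine mul_nonneg ?_ (Real.iSup_nonneg fun ψ => by positivity)
  split_ifs
  · exact Real.iSup_nonneg fun j => abs_nonneg _
  · positivity

lemma mixedNorm_le {q s : ℝ} {W : Type*} {m : ℕ} (σ : Fin m → ℝ) (Mf : Fin m → W → ℝ)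
    (τ : Fin m → ℝ) (hτ : ∀ j, τ j ≠ 0) :
    mixedNorm q s σ Mf ≤ (if q = s then ⨆ j, |τ j|
         else (∑ j, |τ j| ^ (1 / q - 1 / s)⁻¹) ^ (1 / q - 1 / s)) *
        ⨆ ψ : W, (∑ j, |σ j / τ j| ^ s * |Mf j ψ| ^ s) ^ (1 / s) :=
  csInf_le ⟨0, fun x hx => mixedNorm_bdd q s σ Mf x hx⟩ ⟨τ, hτ, rfl⟩

lemma mixed_cont {s : ℝ} (hs : 0 < s) {W : Type*} [TopologicalSpace W] {m : ℕ} (c : Fin m → ℝ)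
    (Mf : Fin m → W → ℝ) (hM : ∀ j, Continuous (Mf j)) :
    Continuous fun ψ => (∑ j, |c j| ^ s * |Mf j ψ| ^ s) ^ (1 / s) := by
  refine Continuous.rpow_const ?_ fun _ => Or.inr (one_div_pos.2 hs).le
  refine continuous_finsetSum _ fun j _ => continuous_const.mul ?_
  exact (hM j).abs.rpow_const fun _ => Or.inr hs.le

lemma le_mixedNorm {q s : ℝ} (hq : 0 < q) (hqs : q ≤ s) {W : Type*} [TopologicalSpace W]
    [CompactSpace W] {m : ℕ} (σ : Fin m → ℝ) (Mf : Fin m → W → ℝ) (hM : ∀ j, Continuous (Mf j))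
    {ι : Type*} [Fintype ι] (w : ι → ℝ) (hw : ∀ i, 0 ≤ w i) (hw1 : ∑ i, w i = 1) (ψ : ι → W) :
    (∑ j, |σ j| ^ q * ((∑ i, w i * |Mf j (ψ i)| ^ s) ^ (1 / s)) ^ q) ^ (1 / q) ≤
      mixedNorm q s σ Mf := by
  have hs : 0 < s := hq.trans_le hqs
  refine le_csInf ⟨_, fun _ => 1, fun _ => one_ne_zero, rfl⟩ ?_
  rintro x ⟨τ, hτ, rfl⟩
  set N : Fin m → ℝ := fun j => (∑ i, w i * |Mf j (ψ i)| ^ s) ^ (1 / s) with hN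
  have hNs0 : ∀ j, 0 ≤ ∑ i, w i * |Mf j (ψ i)| ^ s := fun j =>
    Finset.sum_nonneg fun i _ => mul_nonneg (hw i) (by positivity)
  have hN0 : ∀ j, 0 ≤ N j := fun j => Real.rpow_nonneg (hNs0 j) _
  have hNs : ∀ j, N j ^ s = ∑ i, w i * |Mf j (ψ i)| ^ s := fun j => by
    rw [hN]; simp only
    rw [← Real.rpow_mul (hNs0 j), one_div_mul_cancel hs.ne', Real.rpow_one]
  set X := ⨆ ψ : W, (∑ j, |σ j / τ j| ^ s * |Mf j ψ| ^ s) ^ (1 / s) with hX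
  have hX0 : 0 ≤ X := Real.iSup_nonneg fun ψ => by positivity
  have hXle : ∀ ψ : W, ∑ j, |σ j / τ j| ^ s * |Mf j ψ| ^ s ≤ X ^ s := fun ψ => by
    have h1 : (∑ j, |σ j / τ j| ^ s * |Mf j ψ| ^ s) ^ (1 / s) ≤ X :=
      le_ciSup (isCompact_range (mixed_cont hs (fun j => σ j / τ j) Mf hM)).bddAbove ψ
    have h0 : 0 ≤ ∑ j, |σ j / τ j| ^ s * |Mf j ψ| ^ s := by positivity
    have h2 := Real.rpow_le_rpow (Real.rpow_nonneg h0 _) h1 hs.le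
    rwa [← Real.rpow_mul h0, one_div_mul_cancel hs.ne', Real.rpow_one] at h2
  have hsum : ∑ j, (|σ j / τ j| * N j) ^ s ≤ X ^ s := by
    calc ∑ j, (|σ j / τ j| * N j) ^ s
        = ∑ i, w i * ∑ j, |σ j / τ j| ^ s * |Mf j (ψ i)| ^ s := by
          simp_rw [Real.mul_rpow (abs_nonneg _) (hN0 _), hNs, Finset.mul_sum]
          rw [Finset.sum_comm]
          refine Finset.sum_congr rfl fun i _ => Finset.sum_congr rfl fun j _ => by ring
      _ ≤ ∑ i, w i * X ^ s := Finset.sum_le_sum fun i _ =>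
          mul_le_mul_of_nonneg_left (hXle _) (hw i)
      _ = X ^ s := by rw [← Finset.sum_mul, hw1, one_mul]
  have hsum0 : 0 ≤ ∑ j, (|σ j / τ j| * N j) ^ s :=
    Finset.sum_nonneg fun j _ => Real.rpow_nonneg (mul_nonneg (abs_nonneg _) (hN0 j)) _
  have hsum' : (∑ j, (|σ j / τ j| * N j) ^ s) ^ (1 / s) ≤ X := by
    have := Real.rpow_le_rpow hsum0 hsum (one_div_pos.2 hs).le
    rwa [← Real.rpow_mul hX0, mul_one_div_cancel hs.ne', Real.rpow_one] at this
  have hprod : ∀ j, |τ j| * (|σ j / τ j| * N j) = |σ j| * N j := fun j => by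
    rw [← mul_assoc, ← abs_mul, mul_div_cancel₀ _ (hτ j)]
  have hL : ∑ j, |σ j| ^ q * N j ^ q = ∑ j, (|τ j| * (|σ j / τ j| * N j)) ^ q :=
    Finset.sum_congr rfl fun j _ => by rw [hprod, Real.mul_rpow (abs_nonneg _) (hN0 j)]
  rw [hL]
  split_ifs with h
  · subst h
    set t := ⨆ j, |τ j| with ht
    have ht0 : 0 ≤ t := Real.iSup_nonneg fun j => abs_nonneg _
    have htj : ∀ j, |τ j| ≤ t := fun j => le_ciSup (f := fun j => |τ j|) (Set.finite_range _).bddAbove j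
    have h0 : ∀ j, 0 ≤ |σ j / τ j| * N j := fun j => mul_nonneg (abs_nonneg _) (hN0 j)
    have h1 : ∑ j, (|τ j| * (|σ j / τ j| * N j)) ^ q ≤ (t * X) ^ q := by
      calc _ ≤ ∑ j, t ^ q * (|σ j / τ j| * N j) ^ q := Finset.sum_le_sum fun j _ => by
            rw [Real.mul_rpow (abs_nonneg _) (h0 j)]
            exact mul_le_mul_of_nonneg_right (Real.rpow_le_rpow (abs_nonneg _) (htj j) hq.le)
              (Real.rpow_nonneg (h0 j) _)
        _ ≤ t ^ q * X ^ q := by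
            rw [← Finset.mul_sum]
            exact mul_le_mul_of_nonneg_left hsum (Real.rpow_nonneg ht0 _)
        _ = _ := (Real.mul_rpow ht0 hX0).symm
    have h2 := Real.rpow_le_rpow (Finset.sum_nonneg fun j _ =>
      Real.rpow_nonneg (mul_nonneg (abs_nonneg _) (h0 j)) _) h1 (one_div_pos.2 hq).le
    rwa [← Real.rpow_mul (mul_nonneg ht0 hX0), mul_one_div_cancel hq.ne', Real.rpow_one] at h2
  · refine (aux_holder hq (lt_of_le_of_ne hqs h) (fun j => |τ j|) (fun j => |σ j / τ j| * N j)
      (fun j => abs_nonneg _) (fun j => mul_nonneg (abs_nonneg _) (hN0 j))).trans ?_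
    exact mul_le_mul_of_nonneg_left hsum' (by positivity)

lemma mixedNorm_le_of {q s : ℝ} (hq : 0 < q) (hqs : q ≤ s) {W : Type*} [TopologicalSpace W]
    [CompactSpace W] {m : ℕ} (σ : Fin m → ℝ) (Mf : Fin m → W → ℝ)
    (hM : ∀ j, Continuous (Mf j)) (B : ℝ) (hB : 0 ≤ B)
    (h : ∀ (ι : Type) [Fintype ι] (w : ι → ℝ), (∀ i, 0 ≤ w i) → ∑ i, w i = 1 → ∀ ψ : ι → W,
      (∑ j, |σ j| ^ q * ((∑ i, w i * |Mf j (ψ i)| ^ s) ^ (1 / s)) ^ q) ^ (1 / q) ≤ B) :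
    mixedNorm q s σ Mf ≤ B := by
  have hs : 0 < s := hq.trans_le hqs
  rcases isEmpty_or_nonempty W with hW | hW
  · refine (mixedNorm_le σ Mf (fun _ => 1) fun _ => one_ne_zero).trans ?_
    rw [Real.iSup_of_isEmpty (ι := W), mul_zero]; exact hB
  rcases hqs.eq_or_lt with hqs | hqs
  · subst hqs
    refine (mixedNorm_le σ Mf (fun _ => 1) fun _ => one_ne_zero).trans ?_
    rw [if_pos rfl]
    have h1 : (⨆ j : Fin m, |(1 : ℝ)|) ≤ 1 := Real.iSup_le (fun j => by simp) zero_le_one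
    have h2 : (⨆ ψ : W, (∑ j, |σ j / 1| ^ q * |Mf j ψ| ^ q) ^ (1 / q)) ≤ B := by
      refine ciSup_le fun ψ => ?_
      have := h Unit (fun _ => 1) (fun _ => zero_le_one) (by simp) (fun _ => ψ)
      refine le_trans (le_of_eq ?_) this
      congr 1
      refine Finset.sum_congr rfl fun j _ => ?_
      have h0 : 0 ≤ |Mf j ψ| ^ q := by positivity
      simp only [div_one, Finset.univ_unique, one_mul, Finset.sum_const, Finset.card_singleton,
        one_smul]
      rw [← Real.rpow_mul h0, one_div_mul_cancel hq.ne', Real.rpow_one]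
    calc _ ≤ 1 * B := mul_le_mul h1 h2 (Real.iSup_nonneg fun ψ => by positivity) zero_le_one
      _ = B := one_mul B
  set p := q / s with hp
  have hp0 : 0 < p := div_pos hq hs
  have hp1 : p < 1 := (div_lt_one hs).2 hqs
  set u : W → Fin m → ℝ := fun ψ j => |σ j| ^ s * |Mf j ψ| ^ s with hu
  have hucont : Continuous u := by
    refine continuous_pi fun j => continuous_const.mul ?_
    exact (hM j).abs.rpow_const fun _ => Or.inr hs.le
  set V := closure (convexHull ℝ (Set.range u)) with hVdef
  have hV : IsCompact V :=
    ((isBounded_convexHull.2 (isCompact_range hucont).isBounded).isCompact_closure)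
  have hc : Convex ℝ V := (convex_convexHull ℝ _).closure
  have huV : ∀ ψ, u ψ ∈ V := fun ψ => subset_closure (subset_convexHull ℝ _ ⟨ψ, rfl⟩)
  have hne : V.Nonempty := ⟨_, huV hW.some⟩
  have key : V ⊆ {v | (∀ j, 0 ≤ v j) ∧ ∑ j, v j ^ p ≤ B ^ q} := by
    refine closure_minimal ?_ ?_
    · intro v hv
      obtain ⟨ι, _, w, z, hw, hw1, hz, rfl⟩ := mem_convexHull_iff_exists_fintype.1 hv
      choose ψ hψ using hz
      have hval : ∀ j, (∑ i, w i • z i) j = |σ j| ^ s * ∑ i, w i * |Mf j (ψ i)| ^ s := by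
        intro j
        rw [Finset.sum_apply, Finset.mul_sum]
        refine Finset.sum_congr rfl fun i _ => ?_
        rw [Pi.smul_apply, ← hψ i, smul_eq_mul]; simp only [hu]; ring
      have h0 : ∀ j, 0 ≤ ∑ i, w i * |Mf j (ψ i)| ^ s := fun j =>
        Finset.sum_nonneg fun i _ => mul_nonneg (hw i) (by positivity)
      refine ⟨fun j => by rw [hval]; exact mul_nonneg (by positivity) (h0 j), ?_⟩
      have h1 := h ι w hw hw1 ψ
      have h2 : ∑ j, (∑ i, w i • z i) j ^ p =
          ∑ j, |σ j| ^ q * ((∑ i, w i * |Mf j (ψ i)| ^ s) ^ (1 / s)) ^ q := by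
        refine Finset.sum_congr rfl fun j _ => ?_
        rw [hval, Real.mul_rpow (by positivity) (h0 j), ← Real.rpow_mul (abs_nonneg _),
          ← Real.rpow_mul (h0 j), hp]
        congr 2
        · field_simp
        · field_simp
      have h3 : 0 ≤ ∑ j, |σ j| ^ q * ((∑ i, w i * |Mf j (ψ i)| ^ s) ^ (1 / s)) ^ q :=
        Finset.sum_nonneg fun j _ => mul_nonneg (by positivity)
          (Real.rpow_nonneg (Real.rpow_nonneg (h0 j) _) _)
      rw [h2]
      have h4 := Real.rpow_le_rpow (Real.rpow_nonneg h3 _) h1 hq.le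
      rwa [← Real.rpow_mul h3, one_div_mul_cancel hq.ne', Real.rpow_one] at h4
    · refine IsClosed.inter (s₁ := {v : Fin m → ℝ | ∀ j, 0 ≤ v j})
        (s₂ := {v : Fin m → ℝ | ∑ j, v j ^ p ≤ B ^ q}) ?_ ?_
      · rw [Set.ofPred_forall]
        exact isClosed_iInter fun j => isClosed_le continuous_const (continuous_apply j)
      · refine isClosed_le (continuous_finsetSum _ fun j _ => ?_) continuous_const
        exact (continuous_apply j).rpow_const fun _ => Or.inr hp0.le
  have main : ∀ ε : ℝ, 0 < ε → mixedNorm q s σ Mf ≤ (B ^ q + m * ε ^ p) ^ (1 / q) := by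
    intro ε hε
    obtain ⟨y, hy, hyS, hyV⟩ := aux_core V hV hc hne (fun v hv => (key hv).1) hp0 hp1.le (B ^ q)
      (fun v hv => (key hv).2) hε
    have hθ : 0 < 1 / q - 1 / s := sub_pos.2 (one_div_lt_one_div_of_lt hq hqs)
    set Y := ∑ j, y j ^ p with hY
    have hY0 : 0 ≤ Y := Finset.sum_nonneg fun j _ => Real.rpow_nonneg (hy j).le _
    have hτ : ∀ j, 0 < y j ^ ((1 - p) / s) := fun j => Real.rpow_pos_of_pos (hy j) _
    refine (mixedNorm_le σ Mf (fun j => y j ^ ((1 - p) / s)) fun j => (hτ j).ne').trans ?_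
    rw [if_neg hqs.ne]
    have e1 : ∑ j, |y j ^ ((1 - p) / s)| ^ (1 / q - 1 / s)⁻¹ = Y := by
      refine Finset.sum_congr rfl fun j _ => ?_
      rw [abs_of_pos (hτ j), ← Real.rpow_mul (hy j).le]
      congr 1
      have : s - q ≠ 0 := (sub_pos.2 hqs).ne'
      rw [hp]; field_simp
    have e2 : (⨆ ψ : W, (∑ j, |σ j / y j ^ ((1 - p) / s)| ^ s * |Mf j ψ| ^ s) ^ (1 / s))
        ≤ Y ^ (1 / s) := by
      refine ciSup_le fun ψ => ?_
      refine Real.rpow_le_rpow (by positivity) ?_ (one_div_pos.2 hs).le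
      refine le_trans (le_of_eq ?_) (hyV _ (huV ψ))
      refine Finset.sum_congr rfl fun j _ => ?_
      rw [abs_div, abs_of_pos (hτ j), Real.div_rpow (abs_nonneg _) (hτ j).le,
        ← Real.rpow_mul (hy j).le, div_mul_cancel₀ _ hs.ne', ← neg_sub 1 p,
        Real.rpow_neg (hy j).le]
      simp only [hu]; ring
    rw [e1]
    calc _ ≤ Y ^ (1 / q - 1 / s) * Y ^ (1 / s) :=
          mul_le_mul_of_nonneg_left e2 (Real.rpow_nonneg hY0 _)
      _ = Y ^ (1 / q) := by
          rw [← Real.rpow_add_of_nonneg hY0 hθ.le (one_div_pos.2 hs).le]; congr 1; ring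
      _ ≤ _ := Real.rpow_le_rpow hY0 hyS (one_div_pos.2 hq).le
  have hcont : Continuous fun ε : ℝ => (B ^ q + m * ε ^ p) ^ (1 / q) := by
    refine Continuous.rpow_const ?_ fun _ => Or.inr (one_div_pos.2 hq).le
    refine continuous_const.add (continuous_const.mul ?_)
    exact continuous_id.rpow_const fun _ => Or.inr hp0.le
  have hlim : Filter.Tendsto (fun ε : ℝ => (B ^ q + m * ε ^ p) ^ (1 / q))
      (nhdsWithin 0 (Set.Ioi 0)) (nhds B) := by
    have := (hcont.tendsto 0).mono_left (nhdsWithin_le_nhds (s := Set.Ioi 0))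
    rwa [Real.zero_rpow hp0.ne', mul_zero, add_zero, ← Real.rpow_mul hB,
      mul_one_div_cancel hq.ne', Real.rpow_one] at this
  exact ge_of_tendsto hlim (eventually_nhdsWithin_of_forall fun ε hε => main ε hε)

lemma summing_incl {q₁ q₂ : ℝ} (hq₁ : 0 < q₁) (h₁₂ : q₁ ≤ q₂) {X K : Type*} [TopologicalSpace K]
    [CompactSpace K] (N : X → ℝ) (hN : ∀ x, 0 ≤ N x) (h : X → K → ℝ)
    (hh : ∀ x, Continuous (h x)) (δ : ℝ) (hδ : 0 ≤ δ)
    (H : ∀ m : ℕ, ∀ σ : Fin m → ℝ, (∀ j, σ j ≠ 0) → ∀ x : Fin m → X,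
      (∑ j, |σ j| ^ q₁ * N (x j) ^ q₁) ^ (1 / q₁) ≤
        δ * ⨆ φ : K, (∑ j, |σ j| ^ q₁ * |h (x j) φ| ^ q₁) ^ (1 / q₁))
    (m : ℕ) (σ : Fin m → ℝ) (hσ : ∀ j, σ j ≠ 0) (x : Fin m → X) :
      (∑ j, |σ j| ^ q₂ * N (x j) ^ q₂) ^ (1 / q₂) ≤
        δ * ⨆ φ : K, (∑ j, |σ j| ^ q₂ * |h (x j) φ| ^ q₂) ^ (1 / q₂) := by
  classical
  rcases h₁₂.eq_or_lt with h₁₂ | h₁₂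
  · subst h₁₂; exact H m σ hσ x
  have hq₂ : 0 < q₂ := hq₁.trans h₁₂
  have hθ : 0 < 1 / q₁ - 1 / q₂ := sub_pos.2 (one_div_lt_one_div_of_lt hq₁ h₁₂)
  set θ := 1 / q₁ - 1 / q₂ with hθdef
  set R := ∑ j, |σ j| ^ q₂ * N (x j) ^ q₂ with hR
  set S := ⨆ φ : K, (∑ j, |σ j| ^ q₂ * |h (x j) φ| ^ q₂) ^ (1 / q₂) with hS
  have hS0 : 0 ≤ S := Real.iSup_nonneg fun φ => by positivity
  have hSle : ∀ φ, (∑ j, |σ j| ^ q₂ * |h (x j) φ| ^ q₂) ^ (1 / q₂) ≤ S := fun φ =>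
    le_ciSup (isCompact_range (mixed_cont hq₂ σ (fun j => h (x j)) fun j => hh _)).bddAbove φ
  have hR0 : 0 ≤ R := Finset.sum_nonneg fun j _ =>
    mul_nonneg (by positivity) (Real.rpow_nonneg (hN _) _)
  rcases hR0.eq_or_lt with hR1 | hR1
  · rw [← hR1, Real.zero_rpow (one_div_pos.2 hq₂).ne']; exact mul_nonneg hδ hS0
  let P := {j : Fin m // N (x j) ≠ 0}
  let e : Fin (Fintype.card P) ≃ P := (Fintype.equivFin P).symm
  have hsub : ∀ F : Fin m → ℝ, ∑ i, F (e i) = ∑ j with N (x j) ≠ 0, F j := fun F => by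
    rw [Equiv.sum_comp e (fun j : P => F j)]
    exact (Finset.sum_subtype _ (by simp) F).symm
  have hNe : ∀ i, 0 < N (x (e i)) := fun i => lt_of_le_of_ne (hN _) (e i).2.symm
  let f : Fin m → ℝ := fun j => (|σ j| * N (x j)) ^ (q₂ * θ)
  have hf0 : ∀ j, 0 ≤ f j := fun j => Real.rpow_nonneg (mul_nonneg (abs_nonneg _) (hN _)) _
  have hfe : ∀ i, 0 < f (e i) := fun i =>
    Real.rpow_pos_of_pos (mul_pos (abs_pos.2 (hσ _)) (hNe i)) _
  have hfr : ∀ j, f j ^ θ⁻¹ = |σ j| ^ q₂ * N (x j) ^ q₂ := fun j => by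
    rw [← Real.rpow_mul (mul_nonneg (abs_nonneg _) (hN _)), mul_inv_cancel_right₀ hθ.ne',
      Real.mul_rpow (abs_nonneg _) (hN _)]
  have hRsub : ∑ i, |σ (e i)| ^ q₂ * N (x (e i)) ^ q₂ = R := by
    rw [hsub (fun j => |σ j| ^ q₂ * N (x j) ^ q₂), hR]
    refine Finset.sum_filter_of_ne fun j _ hj h0 => hj ?_
    rw [h0, Real.zero_rpow hq₂.ne', mul_zero]
  have h1 := H _ (fun i => f (e i) * σ (e i)) (fun i => mul_ne_zero (hfe i).ne' (hσ _))
    (fun i => x (e i))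
  have hL : ∑ i, |f (e i) * σ (e i)| ^ q₁ * N (x (e i)) ^ q₁ = R := by
    rw [← hRsub]
    refine Finset.sum_congr rfl fun i _ => ?_
    have hp : 0 < |σ (e i)| * N (x (e i)) := mul_pos (abs_pos.2 (hσ _)) (hNe i)
    rw [abs_mul, abs_of_pos (hfe i), ← Real.mul_rpow (by positivity) (hN _), mul_assoc,
      ← Real.mul_rpow (abs_nonneg _) (hN _)]
    simp only [f]
    rw [← Real.rpow_add_one hp.ne', ← Real.rpow_mul hp.le]
    congr 1
    rw [hθdef]; field_simp; ring
  rw [hL] at h1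
  have h2 : (⨆ φ : K, (∑ i, |f (e i) * σ (e i)| ^ q₁ * |h (x (e i)) φ| ^ q₁) ^ (1 / q₁)) ≤
      R ^ θ * S := by
    refine Real.iSup_le (fun φ => ?_) (mul_nonneg (Real.rpow_nonneg hR0 _) hS0)
    have h3 := aux_holder hq₁ h₁₂ (fun i => f (e i)) (fun i => |σ (e i)| * |h (x (e i)) φ|)
      (fun i => hf0 _) (fun i => by positivity)
    have e1 : ∑ i, (f (e i) * (|σ (e i)| * |h (x (e i)) φ|)) ^ q₁ =
        ∑ i, |f (e i) * σ (e i)| ^ q₁ * |h (x (e i)) φ| ^ q₁ :=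
      Finset.sum_congr rfl fun i _ => by
        rw [abs_mul, abs_of_pos (hfe i), ← Real.mul_rpow (mul_nonneg (hf0 _) (abs_nonneg _))
          (abs_nonneg _), mul_assoc]
    rw [e1] at h3
    refine h3.trans ?_
    rw [← hθdef]
    simp only [hfr]
    rw [hRsub]
    refine mul_le_mul_of_nonneg_left (le_trans ?_ (hSle φ)) (Real.rpow_nonneg hR0 _)
    refine Real.rpow_le_rpow (by positivity) ?_ (one_div_pos.2 hq₂).le
    simp only [Real.mul_rpow (abs_nonneg _) (abs_nonneg _)]
    rw [hsub (fun j => |σ j| ^ q₂ * |h (x j) φ| ^ q₂)]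
    exact Finset.sum_le_sum_of_subset_of_nonneg (Finset.filter_subset _ _)
      fun j _ _ => by positivity
  have h4 : R ^ θ * R ^ (1 / q₂) ≤ R ^ θ * (δ * S) := by
    rw [← Real.rpow_add hR1]
    have : θ + 1 / q₂ = 1 / q₁ := by rw [hθdef]; ring
    rw [this]
    calc _ ≤ _ := h1
      _ ≤ δ * (R ^ θ * S) := mul_le_mul_of_nonneg_left h2 hδ
      _ = _ := by ring
  exact le_of_mul_le_mul_left h4 (Real.rpow_pos_of_pos hR1 _)

lemma aux_jensen {ι : Type*} [Fintype ι] (w z : ι → ℝ) (hw : ∀ i, 0 ≤ w i) (hw1 : ∑ i, w i = 1)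
    (hz : ∀ i, 0 ≤ z i) {s₁ s₂ : ℝ} (hs : 0 < s₂) (h : s₂ ≤ s₁) :
    (∑ i, w i * z i ^ s₂) ^ (1 / s₂) ≤ (∑ i, w i * z i ^ s₁) ^ (1 / s₁) := by
  have hs1 : 0 < s₁ := hs.trans_le h
  have h1 := Real.arith_mean_le_rpow_mean Finset.univ w (fun i => z i ^ s₂) (fun i _ => hw i) hw1
    (fun i _ => Real.rpow_nonneg (hz i) _) (p := s₁ / s₂) ((one_le_div hs).2 h)
  have e : ∀ i, (z i ^ s₂) ^ (s₁ / s₂) = z i ^ s₁ := fun i => by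
    rw [← Real.rpow_mul (hz i), mul_div_cancel₀ _ hs.ne']
  simp only [e] at h1
  have h0 : 0 ≤ ∑ i, w i * z i ^ s₁ :=
    Finset.sum_nonneg fun i _ => mul_nonneg (hw i) (Real.rpow_nonneg (hz i) _)
  have h2 := Real.rpow_le_rpow (Finset.sum_nonneg fun i _ =>
    mul_nonneg (hw i) (Real.rpow_nonneg (hz i) _)) h1 (one_div_pos.2 hs).le
  refine h2.trans (le_of_eq ?_)
  rw [← Real.rpow_mul h0]
  congr 1
  field_simp

/-- inclusion result: if `q₁ ≤ q₂ ≤ s₂ ≤ s₁` then every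
H–M-`((s₁;q₁),q₁)`-mixing map is H–M-`((s₂;q₂),q₂)`-mixing, under the hypotheses of the
Pietsch domination theorem for mixing maps for both parameter pairs. -/
theorem stmt_6
    {A B C D G K W : Type*} [Nonempty A] [Nonempty B] [Nonempty C] [Nonempty D]
    [NormedAddCommGroup G] [NormedSpace ℝ G] [CompleteSpace G]
    [TopologicalSpace K] [CompactSpace K] [T2Space K] [MeasurableSpace K] [BorelSpace K]
    [TopologicalSpace W] [CompactSpace W] [T2Space W] [MeasurableSpace W] [BorelSpace W]
    (𝓗 : Set (A → B)) (𝓗₁ : Set (B → D)) (h𝓗 : 𝓗.Nonempty) (h𝓗₁ : 𝓗₁.Nonempty)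
    (Q₂ : (A → D) → A → C → G → ℝ) (Q₁ : (B → D) → B → C → G → ℝ)
    (H : A → C → G → K → ℝ) (H₁ : B → C → G → W → ℝ)
    (M : (A → B) → A → C → G → W → ℝ)
    (q₁ q₂ s₁ s₂ : ℝ) (hq₁ : 0 < q₁) (h₁₂ : q₁ ≤ q₂) (h₂₃ : q₂ ≤ s₂) (h₃₄ : s₂ ≤ s₁)
    -- Condition (I)
    (hH : ∀ a c g, Continuous fun φ : K => H a c g φ)
    -- Condition (III)
    (hM : ∀ T a c g, Continuous fun ψ : W => M T a c g ψ)
    -- Condition (II)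
    (hcondII : ∀ T ∈ 𝓗, ∀ S ∈ 𝓗₁, ∀ a c g, Q₂ (S ∘ T) a c g ≤ Q₁ S (T a) c g)
    -- Condition (VI)
    (hcondVI : ∀ T ∈ 𝓗, ∀ a c g, ∀ ψ : W, H₁ (T a) c g ψ ≤ M T a c g ψ)
    -- Condition (VII) for the exponent s₁
    (hcondVII₁ : ∀ μ : ProbabilityMeasure W, ∃ J ∈ 𝓗₁,
        (∃ δ > (0 : ℝ), SummingCond s₁ Q₁ H₁ J δ) ∧
        sInf {δ : ℝ | 0 < δ ∧ SummingCond s₁ Q₁ H₁ J δ} ≤ 1 ∧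
        ∀ T ∈ 𝓗, ∀ a c g,
          (∫ ψ, |M T a c g ψ| ^ s₁ ∂(μ : Measure W)) ^ (1 / s₁) ≤ |Q₂ (J ∘ T) a c g|)
    -- Condition (VII) for the exponent s₂
    (hcondVII₂ : ∀ μ : ProbabilityMeasure W, ∃ J ∈ 𝓗₁,
        (∃ δ > (0 : ℝ), SummingCond s₂ Q₁ H₁ J δ) ∧
        sInf {δ : ℝ | 0 < δ ∧ SummingCond s₂ Q₁ H₁ J δ} ≤ 1 ∧
        ∀ T ∈ 𝓗, ∀ a c g,
          (∫ ψ, |M T a c g ψ| ^ s₂ ∂(μ : Measure W)) ^ (1 / s₂) ≤ |Q₂ (J ∘ T) a c g|)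
    (T : A → B) (hT : T ∈ 𝓗) :
    (∃ δ ≥ (0 : ℝ), MixingCond q₁ s₁ q₁ M H T δ) →
      (∃ δ ≥ (0 : ℝ), MixingCond q₂ s₂ q₂ M H T δ) := by
  rintro ⟨δ, hδ, hmix⟩
  have hq₂ : 0 < q₂ := hq₁.trans_le h₁₂
  have hs₂ : 0 < s₂ := hq₂.trans_le h₂₃
  refine ⟨δ, hδ, fun m σ hσ a c g => ?_⟩
  refine mixedNorm_le_of hq₂ h₂₃ σ _ (fun j => hM _ _ _ _) _
    (mul_nonneg hδ (Real.iSup_nonneg fun φ => by positivity)) ?_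
  intro ι _ w hw hw1 ψ
  have hN0 : ∀ (s : ℝ) (x : A × C × G),
      0 ≤ (∑ i, w i * |M T x.1 x.2.1 x.2.2 (ψ i)| ^ s) ^ (1 / s) := fun s x =>
    Real.rpow_nonneg (Finset.sum_nonneg fun i _ => mul_nonneg (hw i) (by positivity)) _
  have key := summing_incl hq₁ h₁₂
    (fun x : A × C × G => (∑ i, w i * |M T x.1 x.2.1 x.2.2 (ψ i)| ^ s₁) ^ (1 / s₁)) (hN0 s₁)
    (fun (x : A × C × G) (φ : K) => H x.1 x.2.1 x.2.2 φ) (fun x => hH _ _ _) δ hδ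
    (fun n σ' hσ' x => (le_mixedNorm hq₁ (h₁₂.trans (h₂₃.trans h₃₄)) σ'
      (fun j ψ => M T (x j).1 (x j).2.1 (x j).2.2 ψ) (fun j => hM _ _ _ _) w hw hw1 ψ).trans
      (hmix n σ' hσ' (fun j => (x j).1) (fun j => (x j).2.1) (fun j => (x j).2.2)))
    m σ hσ (fun j => (a j, c j, g j))
  refine le_trans ?_ key
  refine Real.rpow_le_rpow (Finset.sum_nonneg fun j _ => mul_nonneg (by positivity)
    (Real.rpow_nonneg (hN0 s₂ (a j, c j, g j)) _)) ?_ (one_div_pos.2 hq₂).le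
  refine Finset.sum_le_sum fun j _ => mul_le_mul_of_nonneg_left ?_ (by positivity)
  exact Real.rpow_le_rpow (hN0 s₂ (a j, c j, g j))
    (aux_jensen w _ hw hw1 (fun i => abs_nonneg _) hs₂ h₃₄) hq₂.le
end

section
/- Let X and Y be pointed metric spaces, T : X → Y a Lipschitz map and 0 < q < s < ∞. Then the following are equivalent, with the same infimum of admissible constants: (a) there is a constant δ ≥ 0 such that for all m, n ∈ ℕ, nonzero reals σ_1,…,σ_m, points x'_1,…,x'_m, x''_1,…,x''_m ∈ X and g_1,…,g_n ∈ Y^#: [∑_{j=1}^m |σ_j|^q (∑_{k=1}^n |g_k(T x'_j) − g_k(T x''_j)|^s)^{q/s}]^{1/q} ≤ δ · sup_{f∈B_{X^#}} (∑_{j=1}^m |σ_j|^q |f(x'_j) − f(x''_j)|^q)^{1/q} · (∑_{k=1}^n Lip(g_k)^s)^{1/s}; (b) there is a constant δ ≥ 0 such that for every Borel probability measure μ on B_{Y^#} (topology of pointwise convergence) there exists a Borel probability measure ν on B_{X^#} (topology of pointwise convergence) with (∫_{B_{Y^#}} |g(T x') − g(T x'')|^s dμ(g))^{1/s} ≤ δ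 · (∫_{B_{X^#}} |f(x') − f(x'')|^q dν(f))^{1/q} for all x', x'' ∈ X. -/
open MeasureTheory Finset

/-- The closed unit ball `B_{Y^#}` of the Lipschitz dual of a pointed metric space `Y`
(with base point `y0`): real-valued `1`-Lipschitz functions vanishing at the base point.
As a subset of `Y → ℝ` (with the product topology) it carries the topology of pointwise
convergence, in which it is compact Hausdorff. -/
def LipBall (Y : Type*) [MetricSpace Y] (y0 : Y) : Set (Y → ℝ) :=
  {g : Y → ℝ | LipschitzWith 1 g ∧ g y0 = 0}

noncomputable instance {Y : Type*} [MetricSpace Y] {y0 : Y} :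
    MeasurableSpace ↥(LipBall Y y0) := borel _

instance {Y : Type*} [MetricSpace Y] {y0 : Y} : BorelSpace ↥(LipBall Y y0) := ⟨rfl⟩

/-- The Lipschitz constant `Lip(g)` of a real-valued function on a metric space. -/
noncomputable def lipNorm {Y : Type*} [MetricSpace Y] (g : Y → ℝ) : ℝ :=
  sInf {L : ℝ | 0 ≤ L ∧ ∀ u v : Y, |g u - g v| ≤ L * dist u v}

/-- Condition (a): the Lipschitz `(s;q)`-mixing inequality for a Lipschitz map
`T : X → Y` with constant `δ`. -/
def LipschitzMixingCond {X Y : Type*} [MetricSpace X] [MetricSpace Y]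
    (x0 : X) (y0 : Y) (T : X → Y) (q s δ : ℝ) : Prop :=
  ∀ m n : ℕ, ∀ σ : Fin m → ℝ, (∀ j, σ j ≠ 0) →
    ∀ x' x'' : Fin m → X, ∀ g : Fin n → Y → ℝ,
    (∀ k, (∃ L : NNReal, LipschitzWith L (g k)) ∧ g k y0 = 0) →
    (∑ j, |σ j| ^ q * (∑ k, |g k (T (x' j)) - g k (T (x'' j))| ^ s) ^ (q / s)) ^ (1 / q) ≤
      δ * (⨆ f : ↥(LipBall X x0),
            (∑ j, |σ j| ^ q * |f.1 (x' j) - f.1 (x'' j)| ^ q) ^ (1 / q)) *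
        (∑ k, lipNorm (g k) ^ s) ^ (1 / s)

/-- Condition (b): the Pietsch-type domination for a Lipschitz map `T : X → Y`
with constant `δ`. -/
def LipschitzDominationCond {X Y : Type*} [MetricSpace X] [MetricSpace Y]
    (x0 : X) (y0 : Y) (T : X → Y) (q s δ : ℝ) : Prop :=
  ∀ μ : ProbabilityMeasure ↥(LipBall Y y0), ∃ ν : ProbabilityMeasure ↥(LipBall X x0),
    ∀ x' x'' : X,
      (∫ g, |g.1 (T x') - g.1 (T x'')| ^ s ∂(μ : Measure ↥(LipBall Y y0))) ^ (1 / s) ≤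
        δ * (∫ f, |f.1 x' - f.1 x''| ^ q ∂(ν : Measure ↥(LipBall X x0))) ^ (1 / q)


lemma aux_sep {K : Type*} [TopologicalSpace K] [CompactSpace K] [T2Space K] [MeasurableSpace K]
    [BorelSpace K] [Nonempty K] {ι : Type*} [Nonempty ι] (D : ι → C(K, ℝ))
    (h : ∀ (m : ℕ) (w : Fin m → ℝ) (i : Fin m → ι), (∀ j, 0 < w j) →
      ∃ x, 0 ≤ ∑ j, w j * D (i j) x) :
    ∃ ν : ProbabilityMeasure K, ∀ i, 0 ≤ ∫ x, D i x ∂(ν : Measure K) := by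
  classical
  set s : Set C(K, ℝ) := {f | Set.MapsTo f Set.univ (Set.Iio 0)} with hs
  set t : Set C(K, ℝ) := convexHull ℝ (Set.range D) with ht
  have hso : IsOpen s := ContinuousMap.isOpen_setOfPred_mapsTo isCompact_univ isOpen_Iio
  have hsc : Convex ℝ s := by
    intro a ha b hb p r hp hr hpr x _
    have h1 : a x < 0 := ha (Set.mem_univ x)
    have h2 : b x < 0 := hb (Set.mem_univ x)
    show p * a x + r * b x < 0
    rcases hp.eq_or_lt with rfl | hp
    · have : r = 1 := by linarith
      subst this; linarith
    · nlinarith [mul_pos hp (neg_pos.2 h1), mul_nonneg hr (neg_pos.2 h2).le]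
  have hdisj : Disjoint s t := by
    rw [Set.disjoint_left]
    intro f hf hft
    obtain ⟨κ, _, z, w, hz, -, hw, -, hsum⟩ := eq_pos_convex_span_of_mem_convexHull hft
    choose i hi using fun k => hz (Set.mem_range_self k)
    let e := (Fintype.equivFin κ).symm
    obtain ⟨x, hx⟩ := h (Fintype.card κ) (fun j => w (e j)) (fun j => i (e j)) (fun j => hw _)
    have h1 : f x < 0 := hf (Set.mem_univ x)
    rw [e.sum_comp (fun k => w k * D (i k) x)] at hx
    rw [← hsum] at h1
    simp [ContinuousMap.sum_apply, ← hi] at h1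
    linarith
  obtain ⟨L, u, hL1, hL2⟩ := geometric_hahn_banach_open hsc hso (convex_convexHull ℝ _) hdisj
  have key : ∀ g : C(K, ℝ), (∀ x, 0 ≤ g x) → ∀ c : ℝ, 0 ≤ c → ∀ ε : ℝ, 0 < ε →
      - (c * L g) - ε * L 1 < u := by
    intro g hg c hc ε hε
    have := hL1 (-(c • g) - ε • 1) (by
      intro x _
      have := mul_nonneg hc (hg x)
      simp
      linarith)
    simpa using this
  have hpos : ∀ g : C(K, ℝ), (∀ x, 0 ≤ g x) → 0 ≤ L g := by
    intro g hg
    by_contra hneg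
    push Not at hneg
    have := key g hg (|u + L 1| / (-L g)) (by have : 0 < - L g := by linarith
                                              positivity) 1 one_pos
    have h2 : |u + L 1| / (-L g) * L g = - |u + L 1| := by
      rw [div_neg, neg_mul, div_mul_cancel₀ _ hneg.ne]
    rw [h2] at this
    have := le_abs_self (u + L 1)
    linarith
  have hu : 0 ≤ u := by
    by_contra hneg
    push Not at hneg
    have h1 := hpos 1 (by simp)
    have := key 0 (by simp) 0 le_rfl (-u / (L 1 + 1)) (by apply div_pos <;> linarith)
    simp at this
    have h2 : -u / (L 1 + 1) * L 1 ≤ -u := by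
      rw [div_mul_eq_mul_div, div_le_iff₀ (by linarith)]
      nlinarith
    linarith
  have hD : ∀ i, 0 ≤ L (D i) := fun i =>
    hu.trans (hL2 _ (subset_convexHull ℝ _ ⟨i, rfl⟩))
  have h1 : 0 < L 1 := by
    rcases (hpos 1 (by simp)).eq_or_lt with h0 | h0
    · exfalso
      have k1 := key 0 (by simp) 0 le_rfl 1 one_pos
      rw [← h0] at k1
      simp at k1
      obtain ⟨i⟩ := ‹Nonempty ι›
      have k2 := hL2 _ (subset_convexHull ℝ _ ⟨i, rfl⟩)
      have k3 := hpos (‖D i‖ • 1 - D i) (by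
        intro x
        have := (le_abs_self _).trans ((D i).norm_coe_le_norm x)
        simpa using this)
      simp [← h0] at k3
      linarith
    · exact h0
  let Λ : CompactlySupportedContinuousMap K ℝ →ₚ[ℝ] ℝ := PositiveLinearMap.mk₀
    { toFun := fun g => (L 1)⁻¹ * L (g : C(K, ℝ))
      map_add' := by
        intro a b
        have : ((a + b : CompactlySupportedContinuousMap K ℝ) : C(K, ℝ)) = (a : C(K, ℝ)) + b := rfl
        rw [this, map_add, mul_add]
      map_smul' := by
        intro a b
        have : ((a • b : CompactlySupportedContinuousMap K ℝ) : C(K, ℝ)) = a • (b : C(K, ℝ)) := rfl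
        rw [this, map_smul]
        simp
        ring } (by
      intro g hg
      exact mul_nonneg (inv_nonneg.2 h1.le) (hpos _ hg))
  have hint : ∀ g : C(K, ℝ), ∫ x, g x ∂(RealRMK.rieszMeasure Λ) = (L 1)⁻¹ * L g := by
    intro g
    exact RealRMK.integral_rieszMeasure Λ (CompactlySupportedContinuousMap.continuousMapEquiv g)
  have hprob : IsProbabilityMeasure (RealRMK.rieszMeasure Λ) := by
    have := hint 1
    simp [h1.ne'] at this
    constructor
    rw [Measure.real] at this
    rw [← ENNReal.ofReal_toReal (a := RealRMK.rieszMeasure Λ Set.univ), this]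
    · simp
    · intro h; simp [h] at this
  refine ⟨⟨_, hprob⟩, fun i => ?_⟩
  have := hint (D i)
  simp only [ProbabilityMeasure.coe_mk]
  rw [this]
  exact mul_nonneg (inv_nonneg.2 h1.le) (hD i)

lemma aux_compact {Y : Type*} [MetricSpace Y] (y0 : Y) : CompactSpace ↥(LipBall Y y0) := by
  rw [← isCompact_iff_compactSpace]
  refine IsCompact.of_isClosed_subset
    (isCompact_univ_pi (fun y : Y => isCompact_Icc (a := -dist y y0) (b := dist y y0))) ?_ ?_
  · have : LipBall Y y0 = (⋂ (u : Y) (v : Y), {g : Y → ℝ | dist (g u) (g v) ≤ dist u v}) ∩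
        {g | g y0 = 0} := by
      ext g
      simp [LipBall, lipschitzWith_iff_dist_le_mul]
    rw [this]
    refine IsClosed.inter (isClosed_iInter fun u => isClosed_iInter fun v => ?_) ?_
    · exact isClosed_le (by fun_prop) continuous_const
    · exact isClosed_eq (by fun_prop) continuous_const
  · rintro g ⟨hg, hg0⟩ y -
    have := hg.dist_le_mul y y0
    simp [hg0, Real.dist_eq] at this
    exact abs_le.1 this

lemma aux_nonempty {Y : Type*} [MetricSpace Y] (y0 : Y) : Nonempty ↥(LipBall Y y0) :=
  ⟨⟨fun _ => 0, LipschitzWith.const' 0 |>.weaken zero_le_one, rfl⟩⟩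

lemma aux_mem {Y : Type*} [MetricSpace Y] {y0 : Y} {g : Y → ℝ}
    (h : ∀ u v, |g u - g v| ≤ dist u v) (h0 : g y0 = 0) : g ∈ LipBall Y y0 :=
  ⟨LipschitzWith.of_dist_le_mul (by simpa [Real.dist_eq] using h), h0⟩

lemma aux_ball {Y : Type*} [MetricSpace Y] {y0 : Y} (g : ↥(LipBall Y y0)) (u v : Y) :
    |g.1 u - g.1 v| ≤ dist u v := by
  simpa [Real.dist_eq] using g.2.1.dist_le_mul u v

lemma aux_cont {Y : Type*} [MetricSpace Y] {y0 : Y} (u v : Y) {p : ℝ} (hp : 0 ≤ p) :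
    Continuous (fun g : ↥(LipBall Y y0) => |g.1 u - g.1 v| ^ p) := by
  refine (Real.continuous_rpow_const hp).comp ?_
  have h : ∀ y, Continuous (fun g : ↥(LipBall Y y0) => g.1 y) := fun y =>
    (continuous_apply y).comp continuous_subtype_val
  exact ((h u).sub (h v)).abs

lemma aux_lipNorm_nonneg {Y : Type*} [MetricSpace Y] (g : Y → ℝ) : 0 ≤ lipNorm g :=
  Real.sInf_nonneg (fun _ h => h.1)

lemma aux_lipNorm_le {Y : Type*} [MetricSpace Y] {g : Y → ℝ} {L : ℝ} (hL : 0 ≤ L)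
    (h : ∀ u v, |g u - g v| ≤ L * dist u v) : lipNorm g ≤ L :=
  csInf_le ⟨0, fun _ h => h.1⟩ ⟨hL, h⟩

lemma aux_lipNorm {Y : Type*} [MetricSpace Y] {g : Y → ℝ} (hg : ∃ L : NNReal, LipschitzWith L g)
    (u v : Y) : |g u - g v| ≤ lipNorm g * dist u v := by
  obtain ⟨L, hL⟩ := hg
  have hne : {L : ℝ | 0 ≤ L ∧ ∀ u v : Y, |g u - g v| ≤ L * dist u v}.Nonempty :=
    ⟨L, L.2, fun u v => by simpa [Real.dist_eq] using hL.dist_le_mul u v⟩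
  rcases (dist_nonneg (x := u) (y := v)).eq_or_lt with h | h
  · have : u = v := dist_eq_zero.1 h.symm
    simp [this]
  · rw [← div_le_iff₀ h]
    exact le_csInf hne fun b hb => (div_le_iff₀ h).2 (hb.2 u v)

lemma aux_int {Y : Type*} [MetricSpace Y] {y0 : Y} (μ : ProbabilityMeasure ↥(LipBall Y y0))
    {f : ↥(LipBall Y y0) → ℝ} (hf : Continuous f) :
    Integrable f (μ : Measure ↥(LipBall Y y0)) := by
  have := aux_compact y0
  exact (BoundedContinuousFunction.mkOfCompact ⟨f, hf⟩).integrable _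

lemma aux_ab {X Y : Type*} [MetricSpace X] [MetricSpace Y] (x0 : X) (y0 : Y)
    (T : X → Y) (q s : ℝ) (hq : 0 < q) (hqs : q < s) (δ : ℝ) (hδ : 0 ≤ δ)
    (ha : LipschitzMixingCond x0 y0 T q s δ) : LipschitzDominationCond x0 y0 T q s δ := by
  intro μ
  have hs : 0 < s := hq.trans hqs
  have := aux_compact x0
  have := aux_compact y0
  have := aux_nonempty x0
  have := aux_nonempty y0
  let φ : X × X → ℝ := fun p =>
    ∫ g, |g.1 (T p.1) - g.1 (T p.2)| ^ s ∂(μ : Measure ↥(LipBall Y y0))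
  have hφ : ∀ p, 0 ≤ φ p := fun p => integral_nonneg fun g => by positivity
  let E : X × X → C(↥(LipBall X x0), ℝ) := fun p =>
    ⟨fun f => |f.1 p.1 - f.1 p.2| ^ q, aux_cont _ _ hq.le⟩
  let D : X × X → C(↥(LipBall X x0), ℝ) := fun p =>
    δ ^ q • E p - (φ p ^ (q / s)) • 1
  have : Nonempty (X × X) := ⟨(x0, x0)⟩
  obtain ⟨ν, hν⟩ := aux_sep D (by
    intro m w p hw
    let F : C(↥(LipBall X x0), ℝ) := ∑ j, w j • E (p j)
    have hF : ∀ f, F f = ∑ j, w j * |f.1 (p j).1 - f.1 (p j).2| ^ q := by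
      intro f
      simp [F, E, ContinuousMap.sum_apply]
    obtain ⟨f0, -, hf0⟩ := isCompact_univ.exists_isMaxOn Set.univ_nonempty
      (F.continuous.continuousOn)
    have hF0 : ∀ f, 0 ≤ F f := fun f => by
      rw [hF]; exact Finset.sum_nonneg fun j _ => mul_nonneg (hw j).le (by positivity)
    let H : ↥(LipBall Y y0) → Fin m → ℝ := fun g j =>
      |g.1 (T (p j).1) - g.1 (T (p j).2)| ^ s
    let C : Set (Fin m → ℝ) := {v | ∑ j, w j * v j ^ (q / s) ≤ δ ^ q * F f0}
    have hC : IsClosed C := by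
      refine isClosed_le (continuous_finsetSum _ fun j _ => continuous_const.mul ?_)
        continuous_const
      exact (Real.continuous_rpow_const (by positivity)).comp (continuous_apply j)
    have hconv : convexHull ℝ (Set.range H) ⊆ C := by
      intro v hv
      obtain ⟨κ, _, a, z, ha0, ha1, hz, hsum⟩ := mem_convexHull_iff_exists_fintype.1 hv
      choose g hg using hz
      let e := (Fintype.equivFin κ).symm
      have hσ : ∀ j, |w j ^ (1 / q)| ^ q = w j := fun j => by
        rw [abs_of_nonneg (Real.rpow_nonneg (hw j).le _), ← Real.rpow_mul (hw j).le,
          one_div_mul_cancel hq.ne', Real.rpow_one]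
      have hak : ∀ k, (a k ^ (1 / s)) ^ s = a k := fun k => by
        rw [← Real.rpow_mul (ha0 k), one_div_mul_cancel hs.ne', Real.rpow_one]
      have hlip : ∀ k, ∀ u v, |a k ^ (1 / s) * (g k).1 u - a k ^ (1 / s) * (g k).1 v| ≤
          a k ^ (1 / s) * dist u v := fun k u v => by
        rw [← mul_sub, abs_mul, abs_of_nonneg (Real.rpow_nonneg (ha0 k) _)]
        exact mul_le_mul_of_nonneg_left (aux_ball _ _ _) (Real.rpow_nonneg (ha0 k) _)
      have main := ha m (Fintype.card κ) (fun j => w j ^ (1 / q))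
        (fun j => (Real.rpow_pos_of_pos (hw j) _).ne') (fun j => (p j).1) (fun j => (p j).2)
        (fun k y => a (e k) ^ (1 / s) * (g (e k)).1 y) (by
          intro k
          refine ⟨⟨⟨a (e k) ^ (1 / s), Real.rpow_nonneg (ha0 _) _⟩,
            LipschitzWith.of_dist_le_mul ?_⟩, by simp [(g (e k)).2.2]⟩
          intro u v
          exact hlip (e k) u v)
      simp only [hσ] at main
      have hin : ∀ j, ∑ k, |a (e k) ^ (1 / s) * (g (e k)).1 (T (p j).1) -
          a (e k) ^ (1 / s) * (g (e k)).1 (T (p j).2)| ^ s = v j := by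
        intro j
        rw [e.sum_comp (fun k => |a k ^ (1 / s) * (g k).1 (T (p j).1) -
          a k ^ (1 / s) * (g k).1 (T (p j).2)| ^ s), ← hsum, Finset.sum_apply]
        refine Finset.sum_congr rfl fun k _ => ?_
        rw [← mul_sub, abs_mul, abs_of_nonneg (Real.rpow_nonneg (ha0 k) _),
          Real.mul_rpow (Real.rpow_nonneg (ha0 k) _) (abs_nonneg _), hak, ← hg]
        simp [H]
      simp only [hin] at main
      have hv0 : ∀ j, 0 ≤ v j := fun j => by
        rw [← hin]; exact Finset.sum_nonneg fun k _ => by positivity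
      have hS : (⨆ f : ↥(LipBall X x0),
          (∑ j, w j * |f.1 (p j).1 - f.1 (p j).2| ^ q) ^ (1 / q)) ≤ (F f0) ^ (1 / q) := by
        refine ciSup_le fun f => ?_
        rw [← hF]
        exact Real.rpow_le_rpow (hF0 f) (hf0 (Set.mem_univ f)) (by positivity)
      have hR : (∑ k, lipNorm (fun y => a (e k) ^ (1 / s) * (g (e k)).1 y) ^ s) ^ (1 / s) ≤ 1 := by
        refine Real.rpow_le_one
          (Finset.sum_nonneg fun k _ => Real.rpow_nonneg (aux_lipNorm_nonneg _) _) ?_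
          (by positivity)
        rw [e.sum_comp (fun k => lipNorm (fun y => a k ^ (1 / s) * (g k).1 y) ^ s)]
        refine (Finset.sum_le_sum fun k _ => ?_).trans ha1.le
        calc _ ≤ (a k ^ (1 / s)) ^ s :=
              Real.rpow_le_rpow (aux_lipNorm_nonneg _)
                (aux_lipNorm_le (Real.rpow_nonneg (ha0 k) _) (hlip k)) hs.le
          _ = a k := hak k
      have h1 : (∑ j, w j * v j ^ (q / s)) ^ (1 / q) ≤ δ * (F f0) ^ (1 / q) := by
        refine main.trans ?_
        refine (mul_le_of_le_one_right ?_ hR).trans (mul_le_mul_of_nonneg_left hS hδ)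
        refine mul_nonneg hδ (Real.iSup_nonneg fun f => ?_)
        rw [← hF]; exact Real.rpow_nonneg (hF0 f) _
      have hL0 : 0 ≤ ∑ j, w j * v j ^ (q / s) :=
        Finset.sum_nonneg fun j _ => mul_nonneg (hw j).le (Real.rpow_nonneg (hv0 j) _)
      have h2 := Real.rpow_le_rpow (Real.rpow_nonneg hL0 _) h1 hq.le
      rw [Real.mul_rpow hδ (Real.rpow_nonneg (hF0 _) _), ← Real.rpow_mul hL0,
        ← Real.rpow_mul (hF0 _), one_div_mul_cancel hq.ne', Real.rpow_one, Real.rpow_one] at h2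
      exact h2
    have hHint : ∀ j, Integrable (fun g => H g j) (μ : Measure ↥(LipBall Y y0)) := fun j =>
      aux_int μ (aux_cont _ _ hs.le)
    have hmem : (∫ g, H g ∂(μ : Measure ↥(LipBall Y y0))) ∈ C := by
      refine closure_minimal hconv hC ?_
      refine (convex_convexHull ℝ _).closure.integral_mem isClosed_closure ?_
        (Integrable.of_eval hHint)
      exact Filter.Eventually.of_forall fun g =>
        subset_closure (subset_convexHull ℝ _ ⟨g, rfl⟩)
    refine ⟨f0, ?_⟩
    have hmem' : ∑ j, w j * (∫ g, H g ∂(μ : Measure ↥(LipBall Y y0))) j ^ (q / s) ≤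
      δ ^ q * F f0 := hmem
    have : ∀ j, (∫ g, H g ∂(μ : Measure ↥(LipBall Y y0))) j = φ (p j) := fun j =>
      eval_integral hHint j
    simp only [this] at hmem'
    have h3 : ∑ j, w j * D (p j) f0 = δ ^ q * F f0 - ∑ j, w j * φ (p j) ^ (q / s) := by
      rw [hF, Finset.mul_sum, ← Finset.sum_sub_distrib]
      refine Finset.sum_congr rfl fun j _ => ?_
      simp [D, E]
      ring
    rw [h3]
    linarith)
  refine ⟨ν, fun x' x'' => ?_⟩
  have h := hν (x', x'')
  have hEint : Integrable (fun f => E (x', x'') f) (ν : Measure ↥(LipBall X x0)) :=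
    aux_int ν (E _).continuous
  have hI : ∫ f, D (x', x'') f ∂(ν : Measure ↥(LipBall X x0)) =
      δ ^ q * (∫ f, E (x', x'') f ∂(ν : Measure ↥(LipBall X x0))) - φ (x', x'') ^ (q / s) := by
    have : ∀ f, D (x', x'') f = δ ^ q * E (x', x'') f - φ (x', x'') ^ (q / s) := fun f => by
      simp [D]
    simp only [this]
    rw [integral_sub (hEint.const_mul _) (integrable_const _), integral_const_mul]
    simp
  rw [hI] at h
  have hE0 : 0 ≤ ∫ f, E (x', x'') f ∂(ν : Measure ↥(LipBall X x0)) :=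
    integral_nonneg fun f => by simp only [E]; exact Real.rpow_nonneg (abs_nonneg _) _
  have h4 : φ (x', x'') ^ (q / s) ≤
    δ ^ q * (∫ f, E (x', x'') f ∂(ν : Measure ↥(LipBall X x0))) := by linarith
  have h5 := Real.rpow_le_rpow (Real.rpow_nonneg (hφ _) _) h4 (z := 1 / q) (by positivity)
  rw [Real.mul_rpow (Real.rpow_nonneg hδ _) hE0, ← Real.rpow_mul (hφ _), ← Real.rpow_mul hδ,
    mul_one_div_cancel hq.ne', Real.rpow_one] at h5
  have : q / s * (1 / q) = 1 / s := by field_simp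
  rw [this] at h5
  exact h5

lemma aux_ba {X Y : Type*} [MetricSpace X] [MetricSpace Y] (x0 : X) (y0 : Y)
    (T : X → Y) (q s : ℝ) (hq : 0 < q) (hqs : q < s) (δ : ℝ) (hδ : 0 ≤ δ)
    (hb : LipschitzDominationCond x0 y0 T q s δ) : LipschitzMixingCond x0 y0 T q s δ := by
  intro m n σ hσ x' x'' g hg
  have hs : 0 < s := hq.trans hqs
  have := aux_compact x0
  have := aux_nonempty x0
  set S := ∑ k, lipNorm (g k) ^ s with hSdef
  have hl0 : ∀ k, 0 ≤ lipNorm (g k) := fun k => aux_lipNorm_nonneg _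
  have hl : ∀ k u v, |g k u - g k v| ≤ lipNorm (g k) * dist u v := fun k => aux_lipNorm (hg k).1
  have hS0 : 0 ≤ S := Finset.sum_nonneg fun k _ => Real.rpow_nonneg (hl0 k) _
  let M : ℝ := ⨆ f : ↥(LipBall X x0),
            (∑ j, |σ j| ^ q * |f.1 (x' j) - f.1 (x'' j)| ^ q) ^ (1 / q)
  have hM0 : 0 ≤ M := Real.iSup_nonneg fun f => by positivity
  show _ ≤ δ * M * S ^ (1 / s)
  have hFc : Continuous (fun f : ↥(LipBall X x0) =>
      (∑ j, |σ j| ^ q * |f.1 (x' j) - f.1 (x'' j)| ^ q)) :=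
    continuous_finsetSum _ fun j _ => continuous_const.mul (aux_cont _ _ hq.le)
  have hM : ∀ f : ↥(LipBall X x0),
      (∑ j, |σ j| ^ q * |f.1 (x' j) - f.1 (x'' j)| ^ q) ≤ M ^ q := by
    intro f
    have h1 : (∑ j, |σ j| ^ q * |f.1 (x' j) - f.1 (x'' j)| ^ q) ^ (1 / q) ≤ M :=
      le_ciSup (f := fun f : ↥(LipBall X x0) =>
            (∑ j, |σ j| ^ q * |f.1 (x' j) - f.1 (x'' j)| ^ q) ^ (1 / q))
        (isCompact_range
          ((Real.continuous_rpow_const (by positivity)).comp hFc)).bddAbove f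
    have h0 : 0 ≤ (∑ j, |σ j| ^ q * |f.1 (x' j) - f.1 (x'' j)| ^ q) := by positivity
    have h2 := Real.rpow_le_rpow (Real.rpow_nonneg h0 _) h1 hq.le
    rwa [← Real.rpow_mul h0, one_div_mul_cancel hq.ne', Real.rpow_one] at h2
  have claim : ∃ ν : ProbabilityMeasure ↥(LipBall X x0), ∀ u v : X,
      (∑ k, |g k (T u) - g k (T v)| ^ s) ^ (q / s) ≤
        S ^ (q / s) * (δ ^ q * ∫ f, |f.1 u - f.1 v| ^ q ∂(ν : Measure ↥(LipBall X x0))) := by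
    rcases hS0.eq_or_lt with h0 | hSpos
    · refine ⟨⟨Measure.dirac (Classical.arbitrary _), inferInstance⟩, fun u v => ?_⟩
      have hz : ∀ k, lipNorm (g k) = 0 := by
        intro k
        have := (Finset.sum_eq_zero_iff_of_nonneg
          (fun k _ => Real.rpow_nonneg (hl0 k) s)).1 h0.symm k (Finset.mem_univ k)
        exact (Real.rpow_eq_zero (hl0 k) hs.ne').1 this
      have hz' : ∀ k, |g k (T u) - g k (T v)| = 0 := fun k =>
        le_antisymm (by simpa [hz] using hl k (T u) (T v)) (abs_nonneg _)
      rw [← h0]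
      simp only [hz', Real.zero_rpow hs.ne', Finset.sum_const_zero]
      rw [Real.zero_rpow (by positivity)]
      simp
    · have hG : ∀ k, (fun y => (lipNorm (g k))⁻¹ * g k y) ∈ LipBall Y y0 := by
        intro k
        refine aux_mem (fun u v => ?_) (by simp [(hg k).2])
        rw [← mul_sub, abs_mul, abs_of_nonneg (inv_nonneg.2 (hl0 k))]
        rcases (hl0 k).eq_or_lt with h | h
        · simp [← h]
        · rw [inv_mul_le_iff₀ h]; exact hl k u v
      let μ0 : Measure ↥(LipBall Y y0) :=
        ∑ k, ENNReal.ofReal (lipNorm (g k) ^ s / S) • Measure.dirac ⟨_, hG k⟩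
      have hw0 : ∀ k, 0 ≤ lipNorm (g k) ^ s / S := fun k =>
        div_nonneg (Real.rpow_nonneg (hl0 k) _) hS0
      have hp : IsProbabilityMeasure μ0 := by
        constructor
        simp only [μ0, Measure.coe_finsetSum, Finset.sum_apply, Measure.smul_apply, measure_univ,
          smul_eq_mul, mul_one]
        rw [← ENNReal.ofReal_sum_of_nonneg (fun k _ => hw0 k), ← Finset.sum_div, ← hSdef,
          div_self hSpos.ne']
        simp
      obtain ⟨ν, hν⟩ := hb ⟨μ0, hp⟩
      refine ⟨ν, fun u v => ?_⟩
      have h1 := hν u v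
      have hint : ∫ h, |h.1 (T u) - h.1 (T v)| ^ s ∂μ0 =
          (∑ k, |g k (T u) - g k (T v)| ^ s) / S := by
        simp only [μ0]
        rw [integral_finsetSum_measure, Finset.sum_div]
        · refine Finset.sum_congr rfl fun k _ => ?_
          rw [integral_smul_measure, integral_dirac, ENNReal.toReal_ofReal (hw0 k)]
          simp only [smul_eq_mul]
          rw [← mul_sub, abs_mul, abs_of_nonneg (inv_nonneg.2 (hl0 k)),
            Real.mul_rpow (inv_nonneg.2 (hl0 k)) (abs_nonneg _), Real.inv_rpow (hl0 k)]
          rcases (hl0 k).eq_or_lt with h | h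
          · have : |g k (T u) - g k (T v)| = 0 :=
              le_antisymm (by simpa [← h] using hl k (T u) (T v)) (abs_nonneg _)
            rw [this, Real.zero_rpow hs.ne']
            simp
          · have := (Real.rpow_pos_of_pos h s).ne'
            field_simp
        · intro k _
          exact (integrable_dirac (by simp)).smul_measure ENNReal.ofReal_ne_top
      simp only [ProbabilityMeasure.coe_mk] at h1
      rw [hint] at h1
      set A := ∑ k, |g k (T u) - g k (T v)| ^ s with hA
      have hA0 : 0 ≤ A := Finset.sum_nonneg fun k _ => by positivity
      have hI0 : 0 ≤ ∫ f, |f.1 u - f.1 v| ^ q ∂(ν : Measure ↥(LipBall X x0)) :=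
        integral_nonneg fun f => Real.rpow_nonneg (abs_nonneg _) _
      have h2 := Real.rpow_le_rpow (Real.rpow_nonneg (div_nonneg hA0 hS0) _) h1 hq.le
      rw [Real.mul_rpow hδ (Real.rpow_nonneg hI0 _), ← Real.rpow_mul (div_nonneg hA0 hS0),
        ← Real.rpow_mul hI0, one_div_mul_cancel hq.ne', Real.rpow_one, one_div_mul_eq_div,
        Real.div_rpow hA0 hS0, div_le_iff₀' (Real.rpow_pos_of_pos hSpos _)] at h2
      exact h2
  obtain ⟨ν, hν⟩ := claim
  have hsum : ∑ j, |σ j| ^ q * (∑ k, |g k (T (x' j)) - g k (T (x'' j))| ^ s) ^ (q / s) ≤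
      S ^ (q / s) * δ ^ q * M ^ q := by
    calc _ ≤ ∑ j, |σ j| ^ q * (S ^ (q / s) * (δ ^ q *
            ∫ f, |f.1 (x' j) - f.1 (x'' j)| ^ q ∂(ν : Measure ↥(LipBall X x0)))) :=
          Finset.sum_le_sum fun j _ => mul_le_mul_of_nonneg_left (hν _ _) (by positivity)
      _ = S ^ (q / s) * δ ^ q * ∫ f, ∑ j, |σ j| ^ q * |f.1 (x' j) - f.1 (x'' j)| ^ q
            ∂(ν : Measure ↥(LipBall X x0)) := by
          rw [integral_finsetSum _ (fun j _ => (aux_int ν (aux_cont _ _ hq.le)).const_mul _),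
            Finset.mul_sum]
          refine Finset.sum_congr rfl fun j _ => ?_
          rw [integral_const_mul]
          ring
      _ ≤ S ^ (q / s) * δ ^ q * M ^ q := by
          refine mul_le_mul_of_nonneg_left ?_ (by positivity)
          calc _ ≤ ∫ f, M ^ q ∂(ν : Measure ↥(LipBall X x0)) :=
                integral_mono (aux_int ν hFc) (integrable_const _) hM
            _ = M ^ q := by simp
  have h3 := Real.rpow_le_rpow (by positivity) hsum (z := 1 / q) (by positivity)
  refine h3.trans (le_of_eq ?_)
  rw [Real.mul_rpow (by positivity) (by positivity), Real.mul_rpow (by positivity) (by positivity),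
    ← Real.rpow_mul hS0, ← Real.rpow_mul hδ, ← Real.rpow_mul hM0, mul_one_div_cancel hq.ne',
    Real.rpow_one, Real.rpow_one]
  have : q / s * (1 / q) = 1 / s := by field_simp
  rw [this]
  ring

/-- characterization of Lipschitz `(s;q)`-mixing maps: for pointed
metric spaces `X`, `Y`, a Lipschitz map `T : X → Y` and `0 < q < s < ∞`, conditions (a)
and (b) are equivalent, with the same infimum of admissible constants. -/
theorem stmt_14
    {X Y : Type*} [MetricSpace X] [MetricSpace Y] (x0 : X) (y0 : Y)
    (T : X → Y) (hT : ∃ L : NNReal, LipschitzWith L T)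
    (q s : ℝ) (hq : 0 < q) (hqs : q < s) :
    ((∃ δ ≥ (0 : ℝ), LipschitzMixingCond x0 y0 T q s δ) ↔
      (∃ δ ≥ (0 : ℝ), LipschitzDominationCond x0 y0 T q s δ)) ∧
      sInf {δ : ℝ | 0 ≤ δ ∧ LipschitzMixingCond x0 y0 T q s δ} =
        sInf {δ : ℝ | 0 ≤ δ ∧ LipschitzDominationCond x0 y0 T q s δ} := by
  have key : ∀ δ : ℝ, 0 ≤ δ →
      (LipschitzMixingCond x0 y0 T q s δ ↔ LipschitzDominationCond x0 y0 T q s δ) :=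
    fun δ hδ => ⟨aux_ab x0 y0 T q s hq hqs δ hδ, aux_ba x0 y0 T q s hq hqs δ hδ⟩
  refine ⟨exists_congr fun δ => and_congr_right fun hδ => key δ hδ, ?_⟩
  congr 1
  ext δ
  exact and_congr_right fun hδ => key δ hδ
end
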